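/- arXiv:2402.01445 — 3 statements merged into one kernel-verified Lean document; each statement's English description precedes it below -/
import Mathlib

section
/- For every symmetric matrix G : Matrix (Fin n) (Fin n) (ZMod 2) with zero diagonal and every x : Fin n → ZMod 2, the operator X^x Z^{G·ᵥx} fixes the graph state up to the global sign (−1)^{Q_G(x)}: for all s : Fin n → ZMod 2, (−1)^{⟨G ·ᵥ x, s + x⟩} · |G⟩(s + x) = (−1)^{Q_G(x)} · |G⟩(s), i.e. X^x Z^{G·ᵥx} |G⟩ = (−1)^{Q_G(x)} • |G⟩. -/
open Matrix

/-- The sign `(−1)^u` for `u : ZMod 2`. -/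
noncomputable def sgn (u : ZMod 2) : ℂ := if u = 0 then 1 else -1

/-- The quadratic form `Q_G(s) = ∑_{i < j} G i j * s i * s j` of a graph. -/
def qform {n : ℕ} (G : Matrix (Fin n) (Fin n) (ZMod 2)) (s : Fin n → ZMod 2) : ZMod 2 :=
  ∑ i : Fin n, ∑ j : Fin n, if i < j then G i j * s i * s j else 0

/-- The graph state `|G⟩(s) = 2^(−n/2) · (−1)^(Q_G(s))`. -/
noncomputable def graphState {n : ℕ} (G : Matrix (Fin n) (Fin n) (ZMod 2))
    (s : Fin n → ZMod 2) : ℂ :=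
  (((Real.sqrt 2)⁻¹ ^ n : ℝ) : ℂ) * sgn (qform G s)

/-- The inner product `⟨z, s⟩ = ∑ i, z i * s i` in `ZMod 2`. -/
def inn {n : ℕ} (z s : Fin n → ZMod 2) : ZMod 2 := ∑ i, z i * s i

theorem sgn_add (a b : ZMod 2) : sgn (a + b) = sgn a * sgn b := by
  have h : ∀ u : ZMod 2, u = 0 ∨ u = 1 := by decide
  have h2 : (1 : ZMod 2) + 1 = 0 := by decide
  rcases h a with rfl | rfl <;> rcases h b with rfl | rfl <;> simp [sgn, h2]

theorem sum_pairs {n : ℕ} (F : Fin n → Fin n → ZMod 2) (hF : ∀ i, F i i = 0) :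
    ∑ i, ∑ j, F i j = ∑ i, ∑ j, if i < j then F i j + F j i else 0 := by
  have h1 : ∑ i, ∑ j, F i j =
      ∑ i, ∑ j, ((if i < j then F i j else 0) + (if j < i then F i j else 0)) := by
    refine Finset.sum_congr rfl fun i _ => Finset.sum_congr rfl fun j _ => ?_
    rcases lt_trichotomy i j with h | h | h
    · simp [h, h.not_gt]
    · subst h; simp [hF]
    · simp [h, h.not_gt]
  rw [h1]
  simp only [Finset.sum_add_distrib]
  rw [Finset.sum_comm (f := fun i j => if j < i then F i j else 0)]
  simp only [← Finset.sum_add_distrib]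
  refine Finset.sum_congr rfl fun i _ => Finset.sum_congr rfl fun j _ => ?_
  split_ifs <;> simp

theorem key {n : ℕ} (G : Matrix (Fin n) (Fin n) (ZMod 2))
    (hGs : G.IsSymm) (hGd : ∀ i, G i i = 0) (x s : Fin n → ZMod 2) :
    inn (G.mulVec x) (s + x) + qform G (s + x) = qform G x + qform G s := by
  have h1 : inn (G.mulVec x) (s + x) = ∑ i, ∑ j, G i j * x j * (s i + x i) := by
    simp [inn, Matrix.mulVec, dotProduct, Finset.sum_mul]
  rw [h1, sum_pairs _ (by simp [hGd])]
  simp only [qform, ← Finset.sum_add_distrib]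
  refine Finset.sum_congr rfl fun i _ => Finset.sum_congr rfl fun j _ => ?_
  split_ifs
  · rw [hGs.apply i j, Pi.add_apply, Pi.add_apply]
    generalize G i j = g
    generalize x i = a
    generalize x j = b
    generalize s i = c
    generalize s j = d
    revert g a b c d
    decide
  · simp

/-- `X^x Z^{G·ᵥx}` fixes the graph state up to the global sign `(−1)^{Q_G(x)}`. -/
theorem stmt2 {n : ℕ} (G : Matrix (Fin n) (Fin n) (ZMod 2))
    (hGs : G.IsSymm) (hGd : ∀ i, G i i = 0) (x : Fin n → ZMod 2) :
    ∀ s : Fin n → ZMod 2,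
      sgn (inn (G.mulVec x) (s + x)) * graphState G (s + x)
        = sgn (qform G x) * graphState G s := by
  intro s
  unfold graphState
  rw [mul_left_comm, ← sgn_add, key G hGs hGd, sgn_add, mul_left_comm]
end

section
/- Let h m r : ℕ with r ≤ h and r ≤ m, let G_H : Matrix (Fin h) (Fin h) (ZMod 2) be symmetric, Γ : Matrix (Fin m) (Fin h) (ZMod 2), U : Matrix (Fin h) (Fin h) (ZMod 2) and V : Matrix (Fin m) (Fin m) (ZMod 2) invertible, R : Matrix (Fin r) (Fin (h − r)) (ZMod 2), and suppose Γ = V * (Matrix.fromBlocks 1 R 0 0) * U (blocks along finSumFinEquiv). For any x'_H : Fin h → ZMod 2 and b : Fin r → ZMod 2, define z'_H := Uᵀ ·ᵥ w' + G_H ·ᵥ x'_H, where w' : Fin h → ZMod 2 has first r coordinates b and last h − r coordinates Rᵀ ·ᵥ b, and define x'_M := (Vᵀ)⁻¹ ·ᵥ w'', where w'' : Fin m → ZMod 2 has first r coordinates b and last m − r coordinates 0. Then G_H ·ᵥ x'_H + Γᵀ ·ᵥ x'_M = z'_H; that is, the full vector x' := x'_H ⧺ x'_M satisfies (G ·ᵥ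 x')|_H = z'_H for the block matrix G = Matrix.fromBlocks G_H Γᵀ Γ G_M. -/
open Matrix

/-- The equivalence `Fin a ⊕ Fin (b - a) ≃ Fin b` induced by `finSumFinEquiv`, for `a ≤ b`. -/
def eqr {a b : ℕ} (hab : a ≤ b) : Fin a ⊕ Fin (b - a) ≃ Fin b :=
  finSumFinEquiv.trans (finCongr (Nat.add_sub_cancel' hab))

/-- The corrections sent by the simulator are consistent: with
`z'_H := Uᵀ ·ᵥ w' + G_H ·ᵥ x'_H` and `x'_M := (Vᵀ)⁻¹ ·ᵥ w''` as in the paper, one has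
`G_H ·ᵥ x'_H + Γᵀ ·ᵥ x'_M = z'_H`. -/
theorem stmt9 {h m r : ℕ} (hrh : r ≤ h) (hrm : r ≤ m)
    (GH : Matrix (Fin h) (Fin h) (ZMod 2)) (hGHs : GH.IsSymm)
    (Γ : Matrix (Fin m) (Fin h) (ZMod 2))
    (U : Matrix (Fin h) (Fin h) (ZMod 2)) (hU : IsUnit U)
    (V : Matrix (Fin m) (Fin m) (ZMod 2)) (hV : IsUnit V)
    (R : Matrix (Fin r) (Fin (h - r)) (ZMod 2))
    (hΓ : Γ = V * ((Matrix.fromBlocks (1 : Matrix (Fin r) (Fin r) (ZMod 2)) R 0 0).submatrix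
          (⇑(eqr hrm).symm) (⇑(eqr hrh).symm)) * U)
    (x'H : Fin h → ZMod 2) (b : Fin r → ZMod 2) :
    -- `w'` has first `r` coordinates `b` and last `h − r` coordinates `Rᵀ ·ᵥ b`
    let w' : Fin h → ZMod 2 := fun i => Sum.elim b (Rᵀ.mulVec b) ((eqr hrh).symm i)
    let z'H : Fin h → ZMod 2 := Uᵀ.mulVec w' + GH.mulVec x'H
    -- `w''` has first `r` coordinates `b` and last `m − r` coordinates `0`
    let w'' : Fin m → ZMod 2 := fun i => Sum.elim b (fun _ => 0) ((eqr hrm).symm i)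
    let x'M : Fin m → ZMod 2 := (Vᵀ)⁻¹.mulVec w''
    GH.mulVec x'H + Γᵀ.mulVec x'M = z'H := by
  intro w' z'H w'' x'M
  have hdet : IsUnit (Vᵀ).det := by
    rw [Matrix.det_transpose]
    exact (Matrix.isUnit_iff_isUnit_det V).mp hV
  have hVx : Vᵀ.mulVec x'M = w'' := by
    simp only [x'M]
    rw [Matrix.mulVec_mulVec, Matrix.mul_nonsing_inv _ hdet, Matrix.one_mulVec]
  have hw : ((Matrix.fromBlocks (1 : Matrix (Fin r) (Fin r) (ZMod 2)) R 0 0).submatrix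
          (⇑(eqr hrm).symm) (⇑(eqr hrh).symm))ᵀ.mulVec w'' = w' := by
    have e : w'' = Sum.elim b (fun _ => 0) ∘ (eqr hrm).symm := rfl
    rw [e, Matrix.transpose_submatrix, Matrix.submatrix_mulVec_equiv, Matrix.fromBlocks_transpose]
    funext i
    simp only [w', Function.comp_apply, Equiv.symm_symm]
    rw [Function.comp_assoc, Equiv.symm_comp_self, Function.comp_id, Matrix.fromBlocks_mulVec]
    rcases (eqr hrh).symm i with j | j <;> simp
  rw [hΓ, Matrix.transpose_mul, Matrix.transpose_mul, ← Matrix.mulVec_mulVec,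
    ← Matrix.mulVec_mulVec, hVx, hw, add_comm]
end

section
/- Non-signaling core of the black-box impossibility theorem: let l : ℕ and set A := Fin 2 × (Fin l → Fin 2) × Fin 2. Define Ψ : Fin 2 × A × Fin 2 → ℂ by Ψ(q₁, (q₂, w, q₃), q₄) := 1/2 if q₁ = q₂, w = 0 and q₃ = q₄, and 0 otherwise (the tensor product of the Bell pair (|00⟩+|11⟩)/√2 on the first two qubits, an auxiliary register |0…0⟩, and the Bell pair (|00⟩+|11⟩)/√2 on the last two qubits). Let U : Matrix A A ℂ be any unitary matrix (acting on the middle registers) and define Ψ' : Fin 2 × A × Fin 2 → ℂ by Ψ'(q₁, y, q₄) := ∑_{y' : A} U y y' · Ψ(q₁, y', q₄). Then the reduced matrix on the outer two qubits, M : Matrix (Fin 2 × Fin 2) (Fin 2 × Fin 2) ℂ given by M (q₁,q₄) (q₁',q₄') := ∑_{y : A} Ψ'(q₁,y,q₄) · conj (Ψ'(q₁',y,q₄')), equals (1/4) • 1, the maximally mixed state on two qubits. In particular, no operation acting only on the middle registers can create a Bell pair between the two outer qubits. -/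
open Matrix

/-- The middle registers: a qubit, an `l`-bit auxiliary register, and a qubit. -/
abbrev Mid (l : ℕ) := Fin 2 × (Fin l → Fin 2) × Fin 2

/-- The state `Ψ`: a Bell pair between the first outer qubit and the first middle qubit,
the auxiliary register in `|0…0⟩`, and a Bell pair between the last middle qubit and the
last outer qubit. -/
noncomputable def PsiBB (l : ℕ) : Fin 2 × Mid l × Fin 2 → ℂ :=
  fun q => if q.1 = q.2.1.1 ∧ q.2.1.2.1 = 0 ∧ q.2.1.2.2 = q.2.2 then 1 / 2 else 0

/-- Non-signaling core of the black-box impossibility theorem: after any unitary on the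
middle registers, the reduced matrix on the two outer qubits of `Ψ` is the maximally
mixed state `(1/4) • 1`. -/
theorem stmt14 (l : ℕ) (U : Matrix (Mid l) (Mid l) ℂ) (hU : Uᴴ * U = 1) :
    let Ψ' : Fin 2 × Mid l × Fin 2 → ℂ :=
      fun q => ∑ y' : Mid l, U q.2.1 y' * PsiBB l (q.1, y', q.2.2)
    (Matrix.of fun (p : Fin 2 × Fin 2) (p' : Fin 2 × Fin 2) =>
        ∑ y : Mid l, Ψ' (p.1, y, p.2) * (starRingEnd ℂ) (Ψ' (p'.1, y, p'.2)))
      = (1 / 4 : ℂ) • (1 : Matrix (Fin 2 × Fin 2) (Fin 2 × Fin 2) ℂ) := by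
  intro Ψ'
  have key : ∀ (a b : Fin 2) (y : Mid l), Ψ' (a, y, b) = U y (a, 0, b) * (1 / 2) := by
    intro a b y
    change ∑ y' : Mid l, U y y' * PsiBB l (a, y', b) = _
    rw [Finset.sum_eq_single ((a, 0, b) : Mid l)]
    · simp [PsiBB]
    · rintro ⟨c, w, d⟩ _ hne
      have : ¬ (a = c ∧ w = 0 ∧ d = b) := by
        rintro ⟨rfl, rfl, rfl⟩
        exact hne rfl
      simp only [PsiBB, if_neg this, mul_zero]
    · intro h
      exact absurd (Finset.mem_univ _) h
  ext ⟨a, b⟩ ⟨c, d⟩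
  have h := congrFun (congrFun hU (c, 0, d)) (a, 0, b)
  rw [Matrix.mul_apply] at h
  simp only [Matrix.conjTranspose_apply] at h
  have e : ∀ y : Mid l, Ψ' (a, y, b) * (starRingEnd ℂ) (Ψ' (c, y, d))
      = (1 / 4) * (star (U y (c, 0, d)) * U y (a, 0, b)) := by
    intro y
    rw [key, key, map_mul]
    have h2 : (starRingEnd ℂ) (1 / 2) = 1 / 2 := by
      rw [map_div₀, map_one, map_ofNat]
    rw [h2, starRingEnd_apply]
    ring
  simp only [Matrix.of_apply, Matrix.smul_apply, smul_eq_mul]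
  rw [Finset.sum_congr rfl (fun y _ => e y), ← Finset.mul_sum, h]
  congr 1
  simp only [Matrix.one_apply, Prod.mk.injEq, true_and]
  simp only [eq_comm]
end
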